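/- arXiv:1511.08409 — 2 statements merged into one kernel-verified Lean document; each statement's English description precedes it below -/
import Mathlib

section
/- Let α > 0. For every x < 0, the supremum over b ∈ [0,∞) of ∫₀^b f(p)(α + x p) dp equals -x ∫₀^{-α/x} F(p) dp and is attained at the unique maximizer b* = -α/x; for every x ≥ 0, this supremum equals α + x m̄. -/
open MeasureTheory Filter Set

/-- Let `α > 0`. For every `x < 0`, the supremum over `b ∈ [0,∞)` of
`∫₀^b f(p)(α + xp) dp` equals `-x ∫₀^{-α/x} F(p) dp` and is attained at the unique
maximizer `b* = -α/x`; for every `x ≥ 0`, this supremum equals `α + x m̄`. -/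
theorem stmt_15 (f F : ℝ → ℝ) (mbar alpha : ℝ)
    (hf_cont : Continuous f)
    (hf_nonpos : ∀ p ≤ (0 : ℝ), f p = 0)
    (hf_pos : ∀ p : ℝ, 0 < p → 0 < f p)
    (hf_int : (∫ p in Set.Ioi (0 : ℝ), f p) = 1)
    (hf_tail : Filter.Tendsto (fun p : ℝ => p ^ 3 * f p) Filter.atTop (nhds 0))
    (hmean_int : MeasureTheory.IntegrableOn (fun p : ℝ => p * f p) (Set.Ioi 0))
    (hmbar : mbar = ∫ p in Set.Ioi (0 : ℝ), p * f p)
    (hF : ∀ b : ℝ, F b = ∫ p in (0 : ℝ)..b, f p)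
    (halpha : 0 < alpha) :
    (∀ x : ℝ, x < 0 →
      IsGreatest ((fun b : ℝ => ∫ p in (0 : ℝ)..b, f p * (alpha + x * p)) '' Set.Ici (0 : ℝ))
          (-x * ∫ p in (0 : ℝ)..(-alpha / x), F p)
        ∧ (∫ p in (0 : ℝ)..(-alpha / x), f p * (alpha + x * p))
            = -x * ∫ p in (0 : ℝ)..(-alpha / x), F p
        ∧ ∀ b ∈ Set.Ici (0 : ℝ),
            (∫ p in (0 : ℝ)..b, f p * (alpha + x * p))
                = -x * (∫ p in (0 : ℝ)..(-alpha / x), F p) → b = -alpha / x) ∧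
    (∀ x : ℝ, 0 ≤ x →
      sSup ((fun b : ℝ => ∫ p in (0 : ℝ)..b, f p * (alpha + x * p)) '' Set.Ici (0 : ℝ))
        = alpha + x * mbar) := by
  have hg_cont : ∀ x : ℝ, Continuous (fun p : ℝ => f p * (alpha + x * p)) := by
    intro x; fun_prop
  have hgi : ∀ x a b : ℝ, IntervalIntegrable (fun p : ℝ => f p * (alpha + x * p)) volume a b :=
    fun x a b => (hg_cont x).intervalIntegrable a b
  constructor
  · intro x hx
    have hc : 0 < -alpha / x := div_pos_of_neg_of_neg (by linarith) hx
    have hxc : x * (-alpha / x) = -alpha := by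
      have := hx.ne
      rw [mul_div_assoc']
      exact mul_div_cancel_left₀ _ this
    set c := -alpha / x with hcdef
    have hFd : ∀ b, HasDerivAt F (f b) b := by
      intro b
      have : F = fun b => ∫ p in (0 : ℝ)..b, f p := funext hF
      rw [this]
      exact intervalIntegral.integral_hasDerivAt_right (hf_cont.intervalIntegrable _ _)
        (hf_cont.stronglyMeasurableAtFilter _ _) hf_cont.continuousAt
    have hEq : (∫ p in (0 : ℝ)..c, f p * (alpha + x * p)) = -x * ∫ p in (0 : ℝ)..c, F p := by
      have hu : ∀ p ∈ Set.uIcc 0 c, HasDerivAt (fun p : ℝ => alpha + x * p) x p := by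
        intro p _
        simpa using ((hasDerivAt_id p).const_mul x).const_add alpha
      have h := intervalIntegral.integral_mul_deriv_eq_deriv_mul hu (fun p _ => hFd p)
        (continuous_const.intervalIntegrable _ _) (hf_cont.intervalIntegrable _ _)
      have hF0 : F 0 = 0 := by rw [hF]; simp
      simp only [hxc, hF0, intervalIntegral.integral_const_mul] at h
      simp only [mul_comm (f _)]
      rw [h]; ring
    have hlt : ∀ b, 0 ≤ b → b ≠ c →
        (∫ p in (0 : ℝ)..b, f p * (alpha + x * p)) < ∫ p in (0 : ℝ)..c, f p * (alpha + x * p) := by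
      intro b hb hne
      rcases lt_or_gt_of_ne hne with h | h
      · have h1 : 0 < ∫ p in b..c, f p * (alpha + x * p) := by
          apply intervalIntegral.intervalIntegral_pos_of_pos_on (hgi x b c) _ h
          intro p hp
          refine mul_pos (hf_pos p (lt_of_le_of_lt hb hp.1)) ?_
          nlinarith [hp.2]
        have h2 := intervalIntegral.integral_add_adjacent_intervals (hgi x 0 b) (hgi x b c)
        linarith
      · have h1 : 0 < ∫ p in c..b, -(f p * (alpha + x * p)) := by
          apply intervalIntegral.intervalIntegral_pos_of_pos_on (hgi x c b).neg _ h
          intro p hp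
          have h3 := hf_pos p (lt_trans hc hp.1)
          have h4 : alpha + x * p < 0 := by nlinarith [hp.1]
          have := mul_neg_of_pos_of_neg h3 h4
          exact neg_pos.2 this
        rw [intervalIntegral.integral_neg] at h1
        have h2 := intervalIntegral.integral_add_adjacent_intervals (hgi x 0 c) (hgi x c b)
        linarith
    refine ⟨⟨⟨c, hc.le, hEq⟩, ?_⟩, hEq, ?_⟩
    · rintro _ ⟨b, hb, rfl⟩
      rw [← hEq]
      by_cases h : b = c
      · rw [h]
      · exact (hlt b hb h).le
    · intro b hb h
      by_contra hne
      have := hlt b hb hne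
      rw [hEq] at this
      exact absurd h this.ne
  · intro x hx
    have hfi : IntegrableOn f (Set.Ioi 0) := by
      by_contra h
      rw [integral_undef h] at hf_int
      exact zero_ne_one hf_int
    have hsplit : (fun p : ℝ => f p * (alpha + x * p))
        = fun p => alpha * f p + x * (p * f p) := by
      funext p; ring
    have hgI : IntegrableOn (fun p : ℝ => f p * (alpha + x * p)) (Set.Ioi 0) := by
      rw [hsplit]
      exact (hfi.const_mul alpha).add (hmean_int.const_mul x)
    have hval : (∫ p in Set.Ioi (0 : ℝ), f p * (alpha + x * p)) = alpha + x * mbar := by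
      rw [hsplit, integral_add (hfi.const_mul alpha) (hmean_int.const_mul x),
        integral_const_mul, integral_const_mul, hf_int, ← hmbar, mul_one]
    rw [← hval]
    refine IsLUB.csSup_eq ⟨?_, ?_⟩ (Set.Nonempty.image _ ⟨0, Set.self_mem_Ici⟩)
    · rintro _ ⟨b, hb, rfl⟩
      simp only
      rw [intervalIntegral.integral_of_le hb]
      refine setIntegral_mono_set hgI ?_ (Set.Ioc_subset_Ioi_self).eventuallyLE
      refine (ae_restrict_iff' measurableSet_Ioi).2 (Eventually.of_forall fun p hp => ?_)
      have hp' : 0 < p := hp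
      have := hf_pos p hp'
      simp only [Pi.zero_apply]
      positivity
    · intro M hM
      refine le_of_tendsto (intervalIntegral_tendsto_integral_Ioi 0 hgI tendsto_id) ?_
      filter_upwards [eventually_ge_atTop (0 : ℝ)] with b hb
      exact hM ⟨b, hb, rfl⟩
end

section
/- (Theorem 2, value formula.) Let K > 0, 0 ≤ t < T and S ∈ ℝ, and set H := Σ_{j=1}^J Hʲ. Define the multi-source fluid-limit value ṽ(t,S) as the infimum over all J-tuples of measurable control functions b¹,…,b^J : [t,T] → [0,∞) of ( -Σ_{j=1}^J λʲ αʲ ∫ₜ^T Fʲ(bʲ(s)) ds + K·min( S - Σ_{j=1}^J λʲ ∫ₜ^T Gʲ(bʲ(s)) ds, 0)² ). Then ṽ(t,S) = sup over x ∈ (-∞,0] of ( S x - (T-t) H(x) - x²/(4K) ). -/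
open MeasureTheory Filter Set

lemma aux_contInt (g : ℝ → ℝ) (hg : Continuous g) (F : ℝ → ℝ)
    (hF : ∀ b : ℝ, F b = ∫ p in (0 : ℝ)..b, g p) (b : ℝ) : HasDerivAt F (g b) b := by
  have : F = fun b => ∫ p in (0 : ℝ)..b, g p := funext hF
  rw [this]
  exact intervalIntegral.integral_hasDerivAt_right (hg.intervalIntegrable _ _)
    (hg.stronglyMeasurableAtFilter _ _) hg.continuousAt

lemma aux_bounds (g : ℝ → ℝ) (hnn : ∀ p : ℝ, 0 < p → 0 ≤ g p)
    (hint : IntegrableOn g (Ioi 0)) (F : ℝ → ℝ)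
    (hF : ∀ b : ℝ, F b = ∫ p in (0 : ℝ)..b, g p) :
    (∀ b, 0 ≤ b → 0 ≤ F b ∧ F b ≤ ∫ p in Ioi (0 : ℝ), g p) ∧
    Tendsto F atTop (nhds (∫ p in Ioi (0 : ℝ), g p)) := by
  refine ⟨fun b hb => ?_, ?_⟩
  · rw [hF, intervalIntegral.integral_of_le hb]
    constructor
    · exact setIntegral_nonneg measurableSet_Ioc fun p hp => hnn p hp.1
    · apply setIntegral_mono_set hint
      · filter_upwards [ae_restrict_mem measurableSet_Ioi] with p hp using hnn p hp
      · exact (Ioc_subset_Ioi_self).eventuallyLE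
  · have : F = fun b => ∫ p in (0 : ℝ)..b, g p := funext hF
    rw [this]
    exact intervalIntegral_tendsto_integral_Ioi 0 hint tendsto_id

lemma aux_ineq (f : ℝ → ℝ) (hf : Continuous f) (hnn : ∀ p : ℝ, 0 < p → 0 < f p)
    (F G : ℝ → ℝ) (hF : ∀ b : ℝ, F b = ∫ p in (0 : ℝ)..b, f p)
    (hG : ∀ b : ℝ, G b = ∫ p in (0 : ℝ)..b, p * f p) (b c : ℝ) (hb : 0 ≤ b) (hc : 0 ≤ c) :
    c * F b - G b ≤ c * F c - G c := by
  have hpf : Continuous fun p : ℝ => p * f p := by fun_prop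
  have h1 : c * F c - G c - (c * F b - G b) = ∫ p in b..c, (c - p) * f p := by
    have e1 : ∫ p in b..c, f p = F c - F b := by
      rw [hF, hF, intervalIntegral.integral_interval_sub_left] <;>
        exact hf.intervalIntegrable _ _
    have e2 : ∫ p in b..c, p * f p = G c - G b := by
      rw [hG, hG, intervalIntegral.integral_interval_sub_left] <;>
        exact hpf.intervalIntegrable _ _
    have : ∀ p, (c - p) * f p = c * f p - p * f p := fun p => by ring
    simp_rw [this]
    rw [intervalIntegral.integral_sub ((hf.const_mul c).intervalIntegrable _ _)
      (hpf.intervalIntegrable _ _), intervalIntegral.integral_const_mul, e1, e2]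
    ring
  have h2 : 0 ≤ ∫ p in b..c, (c - p) * f p := by
    rcases le_total b c with h | h
    · rw [intervalIntegral.integral_of_le h]
      apply setIntegral_nonneg measurableSet_Ioc
      intro p hp
      exact mul_nonneg (by linarith [hp.2]) (hnn p (by linarith [hp.1])).le
    · rw [intervalIntegral.integral_of_ge h, neg_nonneg]
      apply setIntegral_nonpos measurableSet_Ioc
      intro p hp
      exact mul_nonpos_of_nonpos_of_nonneg (by linarith [hp.1]) (hnn p (by linarith [hp.1])).le
  linarith

lemma aux_parts (f : ℝ → ℝ) (hf : Continuous f)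
    (F G : ℝ → ℝ) (hF : ∀ b : ℝ, F b = ∫ p in (0 : ℝ)..b, f p)
    (hG : ∀ b : ℝ, G b = ∫ p in (0 : ℝ)..b, p * f p) (c : ℝ) :
    ∫ p in (0 : ℝ)..c, F p = c * F c - G c := by
  have hdF := aux_contInt f hf F hF
  have hdG := aux_contInt _ (by fun_prop : Continuous fun p : ℝ => p * f p) G hG
  have hFc : Continuous F := continuous_iff_continuousAt.2 fun b => (hdF b).continuousAt
  have := intervalIntegral.integral_eq_sub_of_hasDerivAt (a := 0) (b := c)
    (f := fun p => p * F p - G p) (f' := F) (fun x _ => by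
      have := ((hasDerivAt_id x).mul (hdF x)).sub (hdG x)
      have e : F x = 1 * F x + id x * f x - x * f x := by simp
      rw [e]
      exact this) (hFc.intervalIntegrable _ _)
  rw [this, hG 0]
  simp

theorem stmt_17 (J : ℕ) (hJ : 1 < J)
    (f F G H : Fin J → ℝ → ℝ) (mbar lam alpha : Fin J → ℝ)
    (hf_cont : ∀ j, Continuous (f j))
    (hf_nonpos : ∀ j, ∀ p ≤ (0 : ℝ), f j p = 0)
    (hf_pos : ∀ j, ∀ p : ℝ, 0 < p → 0 < f j p)
    (hf_int : ∀ j, (∫ p in Set.Ioi (0 : ℝ), f j p) = 1)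
    (hf_tail : ∀ j, Filter.Tendsto (fun p : ℝ => p ^ 3 * f j p) Filter.atTop (nhds 0))
    (hmean_int : ∀ j, MeasureTheory.IntegrableOn (fun p : ℝ => p * f j p) (Set.Ioi 0))
    (hmbar : ∀ j, mbar j = ∫ p in Set.Ioi (0 : ℝ), p * f j p)
    (hF : ∀ j, ∀ b : ℝ, F j b = ∫ p in (0 : ℝ)..b, f j p)
    (hG : ∀ j, ∀ b : ℝ, G j b = ∫ p in (0 : ℝ)..b, p * f j p)
    (hlam : ∀ j, 0 < lam j) (halpha : ∀ j, 0 < alpha j)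
    (hHneg : ∀ j, ∀ x < (0 : ℝ),
      H j x = -(lam j * x) * ∫ p in (0 : ℝ)..(-(alpha j) / x), F j p)
    (hHpos : ∀ j, ∀ x : ℝ, 0 ≤ x → H j x = lam j * (alpha j + x * mbar j))
    (K t T S : ℝ) (hK : 0 < K) (ht : 0 ≤ t) (htT : t < T) :
    sInf {v : ℝ | ∃ b : Fin J → ℝ → ℝ,
        (∀ j, Measurable (b j)) ∧ (∀ j, ∀ s : ℝ, 0 ≤ b j s) ∧
        v = -(∑ j, lam j * alpha j * ∫ s in t..T, F j (b j s))
              + K * (min (S - ∑ j, lam j * ∫ s in t..T, G j (b j s)) 0) ^ 2}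
      = sSup ((fun x : ℝ =>
          S * x - (T - t) * (∑ j, H j x) - x ^ 2 / (4 * K)) '' Set.Iic 0) := by
  have hpf : ∀ j, Continuous fun p : ℝ => p * f j p := fun j =>
    continuous_id.mul (hf_cont j)
  have hFc : ∀ j, Continuous (F j) := fun j => continuous_iff_continuousAt.2 fun b =>
    (aux_contInt _ (hf_cont j) _ (hF j) b).continuousAt
  have hGc : ∀ j, Continuous (G j) := fun j => continuous_iff_continuousAt.2 fun b =>
    (aux_contInt _ (hpf j) _ (hG j) b).continuousAt
  have hfi : ∀ j, IntegrableOn (f j) (Ioi 0) := fun j => by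
    by_contra h
    have := integral_undef h
    rw [hf_int j] at this
    exact one_ne_zero this
  have hFb : ∀ j, (∀ b, 0 ≤ b → 0 ≤ F j b ∧ F j b ≤ 1) ∧ Tendsto (F j) atTop (nhds 1) := by
    intro j
    have := aux_bounds _ (fun p hp => (hf_pos j p hp).le) (hfi j) _ (hF j)
    rwa [hf_int j] at this
  have hGb : ∀ j, (∀ b, 0 ≤ b → 0 ≤ G j b ∧ G j b ≤ mbar j) ∧
      Tendsto (G j) atTop (nhds (mbar j)) := by
    intro j
    have := aux_bounds _ (fun p hp => mul_nonneg hp.le (hf_pos j p hp).le) (hmean_int j) _ (hG j)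
    rwa [← hmbar j] at this
  have hHeq : ∀ j, ∀ x < (0 : ℝ), H j x =
      lam j * (alpha j * F j (-(alpha j) / x) + x * G j (-(alpha j) / x)) := by
    intro j x hx
    rw [hHneg j x hx, aux_parts _ (hf_cont j) _ _ (hF j) (hG j)]
    have hx' : x ≠ 0 := hx.ne
    field_simp
    ring
  have hHle : ∀ j, ∀ x ≤ (0 : ℝ), ∀ b, 0 ≤ b →
      lam j * (alpha j * F j b + x * G j b) ≤ H j x := by
    intro j x hx b hb
    rcases hx.lt_or_eq with hx | rfl
    · rw [hHeq j x hx]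
      apply mul_le_mul_of_nonneg_left _ (hlam j).le
      have hc : 0 ≤ -(alpha j) / x :=
        div_nonneg_of_nonpos (by linarith [halpha j]) hx.le
      have h := aux_ineq _ (hf_cont j) (hf_pos j) _ _ (hF j) (hG j) b _ hb hc
      have hα : alpha j = -x * (-(alpha j) / x) := by
        field_simp [hx.ne]
      set c := -(alpha j) / x
      rw [hα]
      nlinarith [mul_le_mul_of_nonneg_left h (neg_nonneg.2 hx.le)]
    · rw [hHpos j 0 le_rfl]
      apply mul_le_mul_of_nonneg_left _ (hlam j).le
      have := ((hFb j).1 b hb).2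
      nlinarith [halpha j]
  have hTt : 0 < T - t := sub_pos.2 htT
  set A := {v : ℝ | ∃ b : Fin J → ℝ → ℝ,
        (∀ j, Measurable (b j)) ∧ (∀ j, ∀ s : ℝ, 0 ≤ b j s) ∧
        v = -(∑ j, lam j * alpha j * ∫ s in t..T, F j (b j s))
              + K * (min (S - ∑ j, lam j * ∫ s in t..T, G j (b j s)) 0) ^ 2} with hA
  set B := ((fun x : ℝ =>
          S * x - (T - t) * (∑ j, H j x) - x ^ 2 / (4 * K)) '' Set.Iic 0) with hB
  have hquad : ∀ x ≤ (0 : ℝ), ∀ y : ℝ, x * y - x ^ 2 / (4 * K) ≤ K * (min y 0) ^ 2 := by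
    intro x hx y
    have h1 : x * min y 0 - x ^ 2 / (4 * K) ≤ K * (min y 0) ^ 2 := by
      have : K * (min y 0) ^ 2 - (x * min y 0 - x ^ 2 / (4 * K))
          = (2 * K * min y 0 - x) ^ 2 / (4 * K) := by
        field_simp
        ring
      have h2 : 0 ≤ (2 * K * min y 0 - x) ^ 2 / (4 * K) := by positivity
      linarith
    have h3 : x * y ≤ x * min y 0 := mul_le_mul_of_nonpos_left (min_le_left _ _) hx
    linarith
  have hweak : ∀ v ∈ A, ∀ d ∈ B, d ≤ v := by
    rintro v ⟨b, hbm, hb0, rfl⟩ d ⟨x, hx, rfl⟩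
    have hx : x ≤ 0 := hx
    have hq := hquad x hx (S - ∑ j, lam j * ∫ s in t..T, G j (b j s))
    have key : ∀ j, lam j * alpha j * (∫ s in t..T, F j (b j s))
        + x * (lam j * ∫ s in t..T, G j (b j s)) ≤ (T - t) * H j x := by
      intro j
      have iF : IntervalIntegrable (fun s => F j (b j s)) volume t T := by
        rw [intervalIntegrable_iff_integrableOn_Ioc_of_le htT.le]
        refine Measure.integrableOn_of_bounded (M := 1) (by simp)
          ((hFc j).measurable.comp (hbm j)).aestronglyMeasurable (ae_of_all _ fun s => ?_)
        have := (hFb j).1 _ (hb0 j s)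
        rw [Real.norm_of_nonneg this.1]; exact this.2
      have iG : IntervalIntegrable (fun s => G j (b j s)) volume t T := by
        rw [intervalIntegrable_iff_integrableOn_Ioc_of_le htT.le]
        refine Measure.integrableOn_of_bounded (M := mbar j) (by simp)
          ((hGc j).measurable.comp (hbm j)).aestronglyMeasurable (ae_of_all _ fun s => ?_)
        have := (hGb j).1 _ (hb0 j s)
        rw [Real.norm_of_nonneg this.1]; exact this.2
      have h1 := intervalIntegral.integral_mono_on htT.le
        ((iF.const_mul (lam j * alpha j)).add (iG.const_mul (x * lam j)))
        (intervalIntegrable_const (c := H j x)) (fun s _ => by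
          have := hHle j x hx _ (hb0 j s)
          show lam j * alpha j * F j (b j s) + x * lam j * G j (b j s) ≤ H j x
          linarith)
      rw [intervalIntegral.integral_add (iF.const_mul (lam j * alpha j))
        (iG.const_mul (x * lam j)), intervalIntegral.integral_const_mul,
        intervalIntegral.integral_const_mul, intervalIntegral.integral_const, smul_eq_mul] at h1
      linarith
    have hs := Finset.sum_le_sum (fun j (_ : j ∈ Finset.univ) => key j)
    rw [Finset.sum_add_distrib, ← Finset.mul_sum, ← Finset.mul_sum] at hs
    show S * x - (T - t) * (∑ j, H j x) - x ^ 2 / (4 * K) ≤ _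
    linarith
  have hconst : ∀ c : Fin J → ℝ, (∀ j, 0 ≤ c j) →
      -((T - t) * ∑ j, lam j * alpha j * F j (c j))
        + K * (min (S - (T - t) * ∑ j, lam j * G j (c j)) 0) ^ 2 ∈ A := by
    intro c hc
    refine ⟨fun j _ => c j, fun j => measurable_const, fun j _ => hc j, ?_⟩
    simp only [intervalIntegral.integral_const, smul_eq_mul, Finset.mul_sum]
    have e1 : ∀ j, (T - t) * (lam j * alpha j * F j (c j))
        = lam j * alpha j * ((T - t) * F j (c j)) := fun j => by ring
    have e2 : ∀ j, (T - t) * (lam j * G j (c j)) = lam j * ((T - t) * G j (c j)) :=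
      fun j => by ring
    simp only [e1, e2]
  have hAne : A.Nonempty := ⟨_, hconst (fun _ => 0) (fun _ => le_rfl)⟩
  have hBne : B.Nonempty := ⟨_, mem_image_of_mem _ (mem_Iic.2 le_rfl)⟩
  have hAbdd : BddBelow A := ⟨hBne.some, fun v hv => hweak v hv _ hBne.some_mem⟩
  have hBbdd : BddAbove B := ⟨hAne.some, fun d hd => hweak _ hAne.some_mem d hd⟩
  apply le_antisymm _ (csSup_le hBne fun d hd => le_csInf hAne fun v hv => hweak v hv d hd)
  by_cases h0 : 0 ≤ S - (T - t) * ∑ j, lam j * mbar j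
  · -- the value at zero
    have hd : -((T - t) * ∑ j, lam j * alpha j) ∈ B := by
      refine ⟨0, mem_Iic.2 le_rfl, ?_⟩
      simp [hHpos]
    refine le_trans ?_ (le_csSup hBbdd hd)
    have hlim : Tendsto (fun n : ℝ => -((T - t) * ∑ j, lam j * alpha j * F j n)) atTop
        (nhds (-((T - t) * ∑ j, lam j * alpha j))) := by
      have : Tendsto (fun n : ℝ => ∑ j, lam j * alpha j * F j n) atTop
          (nhds (∑ j, lam j * alpha j * 1)) :=
        tendsto_finsetSum _ fun j _ => (hFb j).2.const_mul _
      simp only [mul_one] at this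
      exact (this.const_mul _).neg
    refine ge_of_tendsto hlim ?_
    filter_upwards [eventually_ge_atTop 0] with n hn
    have := hconst (fun _ => n) (fun _ => hn)
    have hle : ∑ j, lam j * G j n ≤ ∑ j, lam j * mbar j :=
      Finset.sum_le_sum fun j _ => mul_le_mul_of_nonneg_left ((hGb j).1 n hn).2 (hlam j).le
    have h2 := mul_le_mul_of_nonneg_left hle hTt.le
    rw [min_eq_right (by linarith)] at this
    refine csInf_le hAbdd ?_
    simpa using this
  · push Not at h0
    set φ : ℝ → ℝ := fun x => S - (T - t) * ∑ j, lam j * G j (-(alpha j) / x) with hφ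
    have hφc : ContinuousOn φ (Iio 0) := by
      refine continuousOn_const.sub (continuousOn_const.mul (continuousOn_finsetSum _ ?_))
      intro j _
      refine continuousOn_const.mul ((hGc j).comp_continuousOn ?_)
      exact continuousOn_const.div continuousOn_id fun x hx => (ne_of_lt hx)
    have hφ0 : Tendsto φ (nhdsWithin 0 (Iio 0)) (nhds (S - (T - t) * ∑ j, lam j * mbar j)) := by
      refine tendsto_const_nhds.sub (Tendsto.const_mul _ (tendsto_finsetSum _ ?_))
      intro j _
      refine Tendsto.const_mul _ ((hGb j).2.comp ?_)
      have := (tendsto_inv_nhdsLT_zero (𝕜 := ℝ)).const_mul_atBot_of_neg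
        (neg_lt_zero.2 (halpha j))
      exact this
    have hcpos : ∀ x < (0 : ℝ), ∀ j, 0 ≤ -(alpha j) / x := fun x hx j =>
      div_nonneg_of_nonpos (by linarith [halpha j]) hx.le
    have hlow : ∀ x < 0, S - (T - t) * ∑ j, lam j * mbar j ≤ φ x := by
      intro x hx
      have hle : ∑ j, lam j * G j (-(alpha j) / x) ≤ ∑ j, lam j * mbar j :=
        Finset.sum_le_sum fun j _ =>
          mul_le_mul_of_nonneg_left ((hGb j).1 _ (hcpos x hx j)).2 (hlam j).le
      have h2 := mul_le_mul_of_nonneg_left hle hTt.le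
      simp only [hφ]; linarith
    set m := S - (T - t) * ∑ j, lam j * mbar j with hm
    set ψ : ℝ → ℝ := fun x => x - 2 * K * min (φ x) 0 with hψ
    have hKm : 2 * K * m < 0 := by nlinarith
    have hψc : ContinuousOn ψ (Iio 0) :=
      continuousOn_id.sub (continuousOn_const.mul (ContinuousOn.inf hφc continuousOn_const))
    obtain ⟨x1, hx1, hx1p⟩ : ∃ x1 < (0:ℝ), 0 < ψ x1 := by
      have hl : Tendsto ψ (nhdsWithin 0 (Iio 0)) (nhds (0 - 2 * K * min m 0)) :=
        (tendsto_nhdsWithin_of_tendsto_nhds tendsto_id).sub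
          (Tendsto.const_mul _ (hφ0.min tendsto_const_nhds))
      rw [min_eq_left h0.le] at hl
      have := (hl.eventually (lt_mem_nhds (show 0 < 0 - 2 * K * m by linarith))).and
        self_mem_nhdsWithin
      obtain ⟨x, h1, h2⟩ := this.exists
      exact ⟨x, h2, h1⟩
    have hx2p : ψ (2 * K * m) ≤ 0 := by
      have : m ≤ min (φ (2 * K * m)) 0 := le_min (hlow _ hKm) h0.le
      simp only [hψ]
      nlinarith
    obtain ⟨x, hx, hxe⟩ : ∃ x ∈ Iio (0:ℝ), ψ x = 0 := by
      have := (isPreconnected_Iio (a := (0:ℝ))).intermediate_value (mem_Iio.2 hKm)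
        (mem_Iio.2 hx1) hψc
      exact this ⟨hx2p, hx1p.le⟩
    have hx : x < 0 := hx
    have hxm : x = 2 * K * min (φ x) 0 := by simp only [hψ] at hxe; linarith
    have hneg : φ x < 0 := by
      by_contra h
      rw [min_eq_right (not_lt.1 h)] at hxm
      linarith
    rw [min_eq_left hneg.le] at hxm
    have h1 := csInf_le hAbdd (hconst (fun j => -(alpha j) / x) (hcpos x hx))
    have h2 := le_csSup hBbdd (mem_image_of_mem _ (mem_Iic.2 hx.le))
    refine h1.trans (le_trans (le_of_eq ?_) h2)
    change _ + K * (min (φ x) 0) ^ 2 = _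
    rw [min_eq_left hneg.le]
    have hsum : ∑ j, H j x = ∑ j, lam j * alpha j * F j (-(alpha j) / x)
        + x * ∑ j, lam j * G j (-(alpha j) / x) := by
      rw [Finset.mul_sum, ← Finset.sum_add_distrib]
      exact Finset.sum_congr rfl fun j _ => by rw [hHeq j x hx]; ring
    have hφx : (T - t) * ∑ j, lam j * G j (-(alpha j) / x) = S - φ x := by
      simp only [hφ]; ring
    have hq : x ^ 2 / (4 * K) = K * φ x ^ 2 := by
      rw [div_eq_iff (by positivity)]
      calc x ^ 2 = (2 * K * φ x) ^ 2 := by rw [← hxm]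
        _ = _ := by ring
    have hxφ : x * φ x = 2 * K * φ x ^ 2 := by
      calc x * φ x = (2 * K * φ x) * φ x := by rw [← hxm]
        _ = _ := by ring
    show _ = S * x - (T - t) * (∑ j, H j x) - x ^ 2 / (4 * K)
    rw [hsum, hq]
    linear_combination x * hφx - hxφ
end
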